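/- Let n be a nonnegative integer and let a, c ∈ ℂ satisfy c + j ≠ 0 for 0 ≤ j ≤ n−1 and 1−c−n+j ≠ 0 for 0 ≤ j ≤ ⌊n/2⌋+1. Then (c−a)_n/(c)_n = Σ_{k=0}^{⌊n/2⌋} C(n,2k) (1−c−k)(1−a)_k (a)_k / ((1−c−n)_{k+1} (c)_k) − Σ_{0 ≤ 2k+1 ≤ n} C(n,2k+1) (1−a)_{k+1} (a)_k / ((1−c−n)_{k+1} (c)_k). (Second reciprocal relation dual to the Chu–Vandermonde–Gauß summation formula.) -/

import Mathlib

/-- Rising factorial (Pochhammer symbol) of a complex number: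
`poch x 0 = 1` and `poch x (m+1) = poch x m * (x + m)`. -/
noncomputable def poch (x : ℂ) : ℕ → ℂ
  | 0 => 1
  | m + 1 => poch x m * (x + (m : ℂ))
theorem poch_add (x : ℂ) (m l : ℕ) : poch x (m + l) = poch x m * poch (x + m) l := by
  induction l with
  | zero => simp [poch]
  | succ l ih =>
    rw [← Nat.add_assoc]
    simp only [poch, ih]
    push_cast
    ring

theorem poch_left (x : ℂ) (m : ℕ) : poch x (m + 1) = x * poch (x + 1) m := by
  rw [Nat.add_comm, poch_add]
  simp [poch]

theorem poch_refl (m : ℕ) : ∀ y : ℂ, poch (1 - y - m) m = (-1) ^ m * poch y m := by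
  induction m with
  | zero => intro y; simp [poch]
  | succ m ih =>
    intro y
    rw [poch_left]
    have h := ih y
    have e : (1 - y - ((m + 1 : ℕ) : ℂ) + 1) = 1 - y - m := by push_cast; ring
    rw [e, h]
    simp only [poch]
    push_cast
    ring

theorem poch_ne (x : ℂ) (m : ℕ) (h : ∀ j : ℕ, j < m → x + (j : ℂ) ≠ 0) : poch x m ≠ 0 := by
  induction m with
  | zero => simp [poch]
  | succ m ih =>
    simp only [poch]
    exact mul_ne_zero (ih fun j hj => h j (by omega)) (h m (by omega))

/-- even term -/
noncomputable def evT (a c : ℂ) (n k : ℕ) : ℂ :=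
  (n.choose (2 * k) : ℂ) * poch (c + k - 1) (n - 2 * k) *
    ((-1) ^ k * poch (1 - a) k * poch a k)

/-- odd term -/
noncomputable def odT (a c : ℂ) (n k : ℕ) : ℂ :=
  (n.choose (2 * k + 1) : ℂ) * poch (c + k) (n - (2 * k + 1)) *
    ((-1) ^ k * poch (1 - a) (k + 1) * poch a k)

theorem choose_poch (x : ℂ) (n j : ℕ) :
    (n.choose j : ℂ) * poch x (n + 1 - j) =
      (x + n - j) * ((n.choose j : ℂ) * poch x (n - j)) := by
  by_cases h : j ≤ n
  · obtain ⟨d, rfl⟩ := Nat.exists_eq_add_of_le h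
    have e1 : j + d + 1 - j = d + 1 := by omega
    have e2 : j + d - j = d := by omega
    rw [e1, e2]
    simp only [poch]
    push_cast
    ring
  · simp [Nat.choose_eq_zero_of_lt (not_le.mp h)]

theorem choose_shift (x : ℂ) (n j : ℕ) :
    (n.choose j : ℂ) * poch x (n - j) =
      (n.choose j : ℂ) * poch (x - 1) (n - j) +
      (j + 1) * ((n.choose (j + 1) : ℂ) * poch x (n - (j + 1))) := by
  by_cases h : j + 1 ≤ n
  · obtain ⟨d, rfl⟩ := Nat.exists_eq_add_of_le h
    have e1 : j + 1 + d - j = d + 1 := by omega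
    have e2 : j + 1 + d - (j + 1) = d := by omega
    have hch := Nat.choose_succ_right_eq (j + 1 + d) j
    rw [e1] at hch
    have hch' : ((j + 1 + d).choose (j + 1) : ℂ) * (j + 1) = ((j + 1 + d).choose j : ℂ) * (d + 1) := by
      exact_mod_cast hch
    rw [e1, e2, poch_left (x - 1)]
    simp only [poch, sub_add_cancel]
    linear_combination (-poch x d) * hch'
  · rw [Nat.choose_eq_zero_of_lt (not_le.mp h)]
    have e : n - j = 0 := by omega
    simp [e, poch]

theorem evT_zero (a c : ℂ) (n : ℕ) : evT a c (n + 1) 0 = (c + n - 1) * evT a c n 0 := by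
  simp [evT, poch]
  ring

theorem evT_succ (a c : ℂ) (n k : ℕ) :
    evT a c (n + 1) (k + 1) =
      (c + n - (k + 1) - 1) * evT a c n (k + 1) - (a + k) * odT a c n k := by
  have h := choose_poch (c + k) n (2 * k + 1 + 1)
  have e1 : 2 * (k + 1) = 2 * k + 1 + 1 := by ring
  have e2 : n + 1 - (2 * k + 1 + 1) = n - (2 * k + 1) := by omega
  have e3 : c + ((k + 1 : ℕ) : ℂ) - 1 = c + k := by push_cast; ring
  unfold evT odT
  rw [e1, e3, Nat.choose_succ_succ, e2]
  rw [e2] at h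
  push_cast at h ⊢
  simp only [poch, pow_succ] at h ⊢
  linear_combination (-((-1) ^ k) * (poch (1 - a) k * (1 - a + k)) * (poch a k * (a + k))) * h

theorem odT_succ (a c : ℂ) (n k : ℕ) :
    odT a c (n + 1) k = (1 - a + k) * evT a c n k + (c + n + k) * odT a c n k := by
  have h := choose_poch (c + k) n (2 * k + 1)
  have h2 := choose_shift (c + k) n (2 * k)
  have e2 : n + 1 - (2 * k + 1) = n - 2 * k := by omega
  unfold evT odT
  rw [Nat.choose_succ_succ, e2]
  rw [e2] at h
  push_cast at h h2 ⊢
  simp only [poch] at h h2 ⊢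
  linear_combination ((-1) ^ k * (poch (1 - a) k * (1 - a + k)) * poch a k) * (h + h2)

theorem step_sum (a c : ℂ) (n M : ℕ) :
    ∑ k ∈ Finset.range (M + 1), (evT a c (n + 1) k + odT a c (n + 1) k) =
      (c - a + n) * ∑ k ∈ Finset.range (M + 1), (evT a c n k + odT a c n k)
       + (a + M) * odT a c n M := by
  induction M with
  | zero =>
    simp [evT_zero, odT_succ]
    ring
  | succ M ih =>
    rw [Finset.sum_range_succ, ih, Finset.sum_range_succ _ (M + 1), evT_succ, odT_succ]
    push_cast
    ring

theorem main_sum (a c : ℂ) (n M : ℕ) (h : n ≤ M) :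
    ∑ k ∈ Finset.range (M + 1), (evT a c n k + odT a c n k) = poch (c - a) n := by
  induction n with
  | zero =>
    rw [Finset.sum_range_succ']
    have : ∀ k, evT a c 0 (k + 1) + odT a c 0 (k + 1) = 0 := by
      intro k
      simp [evT, odT, Nat.mul_add]
    simp [this]
    simp [evT, odT, poch]
  | succ n ih =>
    rw [step_sum, ih (by omega)]
    have : odT a c n M = 0 := by
      unfold odT
      rw [Nat.choose_eq_zero_of_lt (by omega)]
      simp
    rw [this]
    simp only [poch]
    ring

theorem poch_N (c : ℂ) (n k : ℕ) :
    poch (1 - c - n) (k + 1) = (-1) ^ (k + 1) * poch (c + n - k - 1) (k + 1) := by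
  rw [← poch_refl]
  congr 1
  push_cast
  ring

theorem ev_conv (a c : ℂ) (n k : ℕ) (hk : 2 * k ≤ n) (h0 : poch c n ≠ 0) (h1 : poch c k ≠ 0)
    (h2 : poch (1 - c - n) (k + 1) ≠ 0) :
    (n.choose (2 * k) : ℂ) * ((1 - c - (k : ℂ)) * poch (1 - a) k * poch a k) /
          (poch (1 - c - (n : ℂ)) (k + 1) * poch c k) = evT a c n k / poch c n := by
  rw [div_eq_div_iff (mul_ne_zero h2 h1) h0, poch_N]
  obtain ⟨d, rfl⟩ := Nat.exists_eq_add_of_le hk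
  have e : 2 * k + d - 2 * k = d := by omega
  have p1 := poch_add (c + k - 1) d (k + 1)
  have p2 := poch_add c k (k + d)
  have p3 := poch_left (c + k - 1) (k + d)
  have e1 : c + ((2 * k + d : ℕ) : ℂ) - k - 1 = c + k - 1 + d := by push_cast; ring
  have e2 : d + (k + 1) = k + d + 1 := by ring
  have e3 : k + (k + d) = 2 * k + d := by ring
  have e4 : c + (k : ℂ) - 1 + 1 = c + k := by ring
  rw [e2, p3, e4] at p1
  rw [e3] at p2
  unfold evT
  rw [e, e1, p2]
  have s : ((-1 : ℂ) ^ k) * (-1) ^ k = 1 := by rw [← mul_pow]; simp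
  rw [pow_succ]
  generalize poch (c + k - 1 + d) (k + 1) = A at *
  generalize poch (c + k - 1) d = B at *
  generalize poch (c + k) (k + d) = C at *
  generalize (-1 : ℂ) ^ k = S at *
  linear_combination (-((2 * k + d).choose (2 * k) : ℂ) * poch (1 - a) k * poch a k * poch c k) * p1 + (((2 * k + d).choose (2 * k) : ℂ) * poch (1 - a) k * poch a k * poch c k * A * B) * s

theorem od_conv (a c : ℂ) (n k : ℕ) (hk : 2 * k + 1 ≤ n) (h0 : poch c n ≠ 0) (h1 : poch c k ≠ 0)
    (h2 : poch (1 - c - n) (k + 1) ≠ 0) :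
    (n.choose (2 * k + 1) : ℂ) * (poch (1 - a) (k + 1) * poch a k) /
          (poch (1 - c - (n : ℂ)) (k + 1) * poch c k) = -(odT a c n k / poch c n) := by
  rw [← neg_div, div_eq_div_iff (mul_ne_zero h2 h1) h0, poch_N]
  obtain ⟨d, rfl⟩ := Nat.exists_eq_add_of_le hk
  have e : 2 * k + 1 + d - (2 * k + 1) = d := by omega
  have p1 := poch_add (c + k) d (k + 1)
  have p2 := poch_add c k (d + (k + 1))
  have e1 : c + ((2 * k + 1 + d : ℕ) : ℂ) - k - 1 = c + k + d := by push_cast; ring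
  have e3 : k + (d + (k + 1)) = 2 * k + 1 + d := by ring
  rw [e3, p1] at p2
  unfold odT
  rw [e, e1, p2]
  have s : ((-1 : ℂ) ^ k) * (-1) ^ k = 1 := by rw [← mul_pow]; simp
  rw [pow_succ]
  generalize poch (c + k + d) (k + 1) = A at *
  generalize poch (c + k) d = B at *
  generalize (-1 : ℂ) ^ k = S at *
  linear_combination (-((2 * k + 1 + d).choose (2 * k + 1) : ℂ) * poch (1 - a) (k + 1) * poch a k * poch c k * A * B) * s

/-- Second reciprocal relation dual to the Chu–Vandermonde–Gauß summation formula. -/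
theorem cvg_reciprocal_second (n : ℕ) (a c : ℂ)
    (hc : ∀ j : ℕ, j < n → c + (j : ℂ) ≠ 0)
    (hcn : ∀ j : ℕ, j ≤ n / 2 + 1 → 1 - c - (n : ℂ) + (j : ℂ) ≠ 0) :
    poch (c - a) n / poch c n =
      (∑ k ∈ Finset.range (n / 2 + 1),
        (n.choose (2 * k) : ℂ) * ((1 - c - (k : ℂ)) * poch (1 - a) k * poch a k) /
          (poch (1 - c - (n : ℂ)) (k + 1) * poch c k)) -
      ∑ k ∈ Finset.range ((n + 1) / 2),
        (n.choose (2 * k + 1) : ℂ) * (poch (1 - a) (k + 1) * poch a k) /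
          (poch (1 - c - (n : ℂ)) (k + 1) * poch c k) := by
  have h0 : poch c n ≠ 0 := poch_ne c n hc
  have h1 : ∀ k, k ≤ n → poch c k ≠ 0 := fun k hk => poch_ne c k fun j hj => hc j (by omega)
  have h2 : ∀ k, k ≤ n / 2 → poch (1 - c - n) (k + 1) ≠ 0 := fun k hk =>
    poch_ne _ _ fun j hj => hcn j (by omega)
  rw [Finset.sum_congr rfl fun k hk => ev_conv a c n k
      (by have := Finset.mem_range.mp hk; omega) h0
      (h1 k (by have := Finset.mem_range.mp hk; omega))
      (h2 k (by have := Finset.mem_range.mp hk; omega)),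
    Finset.sum_congr rfl fun k hk => od_conv a c n k
      (by have := Finset.mem_range.mp hk; omega) h0
      (h1 k (by have := Finset.mem_range.mp hk; omega))
      (h2 k (by have := Finset.mem_range.mp hk; omega)),
    Finset.sum_neg_distrib, sub_neg_eq_add, ← Finset.sum_div, ← Finset.sum_div, ← add_div,
    ← main_sum a c n n le_rfl, Finset.sum_add_distrib]
  congr 2
  · symm
    apply Finset.sum_subset
    · intro k hk
      have := Finset.mem_range.mp hk
      exact Finset.mem_range.mpr (by omega)
    · intro k _ hk
      have : ¬ k < n / 2 + 1 := fun h => hk (Finset.mem_range.mpr h)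
      unfold evT
      rw [Nat.choose_eq_zero_of_lt (by omega)]
      simp
  · symm
    apply Finset.sum_subset
    · intro k hk
      have := Finset.mem_range.mp hk
      exact Finset.mem_range.mpr (by omega)
    · intro k _ hk
      have : ¬ k < (n + 1) / 2 := fun h => hk (Finset.mem_range.mpr h)
      unfold odT
      rw [Nat.choose_eq_zero_of_lt (by omega)]
      simp
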